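/- arXiv:2212.04691 — 2 statements merged into one kernel-verified Lean document; each statement's English description precedes it below -/
import Mathlib

section
/- Let k ≥ 1, let 𝒜 ⊆ ℝ^k, and let M : 𝒜 → ℝ^k satisfy ⟨A, M(A)⟩ = 1 for every A ∈ 𝒜 and ⟨A', M(A)⟩ ≤ 1 for all A, A' ∈ 𝒜. Fix A₀ ∈ 𝒜 and suppose M is continuous at A₀ (with respect to the subspace topology of 𝒜). Then for every sequence (Aₙ) in 𝒜 with Aₙ → A₀ and Aₙ ≠ A₀ for all n, the normalized inner products ⟨Aₙ − A₀, M(A₀)⟩ / ‖Aₙ − A₀‖ converge to 0. -/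
open scoped RealInnerProductSpace

/-- The normal vector statement for the surface of circumferences: if `M` satisfies
`⟪A, M A⟫ = 1` and `⟪A', M A⟫ ≤ 1` on `𝒜` and is continuous at `A₀ ∈ 𝒜` within `𝒜`,
then for any sequence `Aₙ ∈ 𝒜` with `Aₙ → A₀`, `Aₙ ≠ A₀`, the normalized inner products
`⟪Aₙ - A₀, M A₀⟫ / ‖Aₙ - A₀‖` tend to `0`. -/
theorem normal_vector_limit
    (k : ℕ) (hk : 1 ≤ k)
    (𝒜 : Set (EuclideanSpace ℝ (Fin k)))
    (M : EuclideanSpace ℝ (Fin k) → EuclideanSpace ℝ (Fin k))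
    (hM1 : ∀ A ∈ 𝒜, ⟪A, M A⟫ = 1)
    (hM2 : ∀ A ∈ 𝒜, ∀ A' ∈ 𝒜, ⟪A', M A⟫ ≤ 1)
    (A₀ : EuclideanSpace ℝ (Fin k)) (hA₀ : A₀ ∈ 𝒜)
    (hMcont : ContinuousWithinAt M 𝒜 A₀)
    (A : ℕ → EuclideanSpace ℝ (Fin k))
    (hAmem : ∀ n, A n ∈ 𝒜)
    (hAlim : Filter.Tendsto A Filter.atTop (nhds A₀))
    (hAne : ∀ n, A n ≠ A₀) :
    Filter.Tendsto (fun n => ⟪A n - A₀, M A₀⟫ / ‖A n - A₀‖)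
      Filter.atTop (nhds 0) := by
  have hdiff : Filter.Tendsto (fun n => ‖M (A n) - M A₀‖) Filter.atTop (nhds 0) := by
    rw [← tendsto_iff_norm_sub_tendsto_zero]
    exact hMcont.tendsto.comp
      (tendsto_nhdsWithin_iff.2 ⟨hAlim, Filter.Eventually.of_forall hAmem⟩)
  refine squeeze_zero_norm (fun n => ?_) hdiff
  have hpos : 0 < ‖A n - A₀‖ := norm_pos_iff.2 (sub_ne_zero.2 (hAne n))
  have hle : ⟪A n - A₀, M A₀⟫ ≤ 0 := by
    rw [inner_sub_left, hM1 A₀ hA₀]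
    linarith [hM2 A₀ hA₀ (A n) (hAmem n)]
  have hge : 0 ≤ ⟪A n - A₀, M (A n)⟫ := by
    rw [inner_sub_left, hM1 (A n) (hAmem n)]
    linarith [hM2 (A n) (hAmem n) A₀ hA₀]
  have hcs := real_inner_le_norm (A n - A₀) (M (A n) - M A₀)
  rw [inner_sub_right] at hcs
  rw [Real.norm_eq_abs, abs_div, abs_norm, abs_of_nonpos hle, div_le_iff₀ hpos]
  linarith
end

section
/- Let k ≥ 2 and let A₁, …, A_{k−1}, A_k, A'_k and a_j, a'_j, M_j, M'_j (for j = 1, …, k) be nonnegative real numbers satisfying: A_j ≤ a_j and A_j ≤ a'_j for every j = 1, …, k−1; A_k ≤ a_k; A'_k ≤ a'_k; A_k ≤ A'_k; M_k > 0; ∑_{j=1}^k a_j² M_j = ∑_{j=1}^{k−1} A_j² M_j + A_k² M_k; ∑_{j=1}^k a'_j² M'_j = ∑_{j=1}^{k−1} A_j² M'_j + A'_k² M'_k; ∑_{j=1}^k a'_j² M'_j ≥ ∑_{j=1}^k a'_j² M_j; and ∑_{j=1}^k a_j² M_j ≥ ∑_{j=1}^k a_j² M'_j. Then (A'_k² −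 A_k²)(M_k − M'_k) ≤ 0; in particular, if A_k < A'_k then M'_k ≥ M_k > 0. -/
open Finset

/-- Numerical content of the non-degeneration lemma (Lemma `upper`): if the `k`-th modulus
`M_k > 0`, `A_k ≤ A'_k`, the circumference conditions hold, the norm identities hold, and
the two extremal inequalities hold, then `(A'_k² - A_k²)(M_k - M'_k) ≤ 0`; in particular,
if `A_k < A'_k` then `M'_k ≥ M_k > 0`.  Indices run over `Fin (k+1)` with `1 ≤ k`,
the "`k`-th" index being `Fin.last k`. -/
theorem nondegeneration_lemma
    (k : ℕ) (hk : 1 ≤ k)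
    (A a a' M M' : Fin (k + 1) → ℝ) (A'k : ℝ)
    (hA : ∀ j, 0 ≤ A j) (ha : ∀ j, 0 ≤ a j) (ha' : ∀ j, 0 ≤ a' j)
    (hM : ∀ j, 0 ≤ M j) (hM' : ∀ j, 0 ≤ M' j) (hA'k : 0 ≤ A'k)
    (hAa : ∀ j, A j ≤ a j)
    (hAa' : ∀ j : Fin k, A j.castSucc ≤ a' j.castSucc)
    (hA'a' : A'k ≤ a' (Fin.last k))
    (hAA' : A (Fin.last k) ≤ A'k)
    (hMk : 0 < M (Fin.last k))
    (hnorm : ∑ j, a j ^ 2 * M j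
      = (∑ j : Fin k, A j.castSucc ^ 2 * M j.castSucc)
          + A (Fin.last k) ^ 2 * M (Fin.last k))
    (hnorm' : ∑ j, a' j ^ 2 * M' j
      = (∑ j : Fin k, A j.castSucc ^ 2 * M' j.castSucc) + A'k ^ 2 * M' (Fin.last k))
    (hext' : ∑ j, a' j ^ 2 * M' j ≥ ∑ j, a' j ^ 2 * M j)
    (hext : ∑ j, a j ^ 2 * M j ≥ ∑ j, a j ^ 2 * M' j) :
    (A'k ^ 2 - A (Fin.last k) ^ 2) * (M (Fin.last k) - M' (Fin.last k)) ≤ 0 ∧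
    (A (Fin.last k) < A'k →
      M (Fin.last k) ≤ M' (Fin.last k) ∧ 0 < M (Fin.last k)) := by
  have h1 : (∑ j : Fin k, A j.castSucc ^ 2 * M j.castSucc) + A'k ^ 2 * M (Fin.last k)
      ≤ ∑ j, a' j ^ 2 * M j := by
    rw [Fin.sum_univ_castSucc]
    refine add_le_add (sum_le_sum fun j _ => ?_) ?_
    · exact mul_le_mul_of_nonneg_right (pow_le_pow_left₀ (hA _) (hAa' j) 2) (hM _)
    · exact mul_le_mul_of_nonneg_right (pow_le_pow_left₀ hA'k hA'a' 2) (hM _)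
  have h2 : (∑ j : Fin k, A j.castSucc ^ 2 * M' j.castSucc)
      + A (Fin.last k) ^ 2 * M' (Fin.last k) ≤ ∑ j, a j ^ 2 * M' j := by
    rw [← Fin.sum_univ_castSucc fun j => A j ^ 2 * M' j]
    exact sum_le_sum fun j _ =>
      mul_le_mul_of_nonneg_right (pow_le_pow_left₀ (hA j) (hAa j) 2) (hM' j)
  have key : (A'k ^ 2 - A (Fin.last k) ^ 2) * (M (Fin.last k) - M' (Fin.last k)) ≤ 0 := by
    linarith
  refine ⟨key, fun hlt => ⟨?_, hMk⟩⟩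
  have hsq : 0 < A'k ^ 2 - A (Fin.last k) ^ 2 :=
    sub_pos.mpr (pow_lt_pow_left₀ hlt (hA _) two_ne_zero)
  exact sub_nonpos.mp (nonpos_of_mul_nonpos_right key hsq)
end
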